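/- Second Rogers–Ramanujan identity (combinatorial form): for every nonnegative integer n, the number of partitions of n whose parts are all congruent to 2 or 3 modulo 5 equals the number of partitions b₁ ≥ b₂ ≥ ⋯ ≥ b_s of n with b_j − b_{j+1} ≥ 2 for all 1 ≤ j < s and with smallest part b_s ≥ 2. -/

import Mathlib

namespace RR
open Finset

/-- Triangular numbers `k(k-1)/2`. -/
def tri : ℕ → ℕ
  | 0 => 0
  | k + 1 => tri k + k

lemma two_tri (k : ℕ) : 2 * tri k + k = k * k := by
  induction k with
  | zero => rfl
  | succ k ih => simp only [tri]; linarith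

lemma tri_add (a b : ℕ) : tri (a + b) = tri a + tri b + a * b := by
  induction b with
  | zero => simp [tri]
  | succ b ih => rw [← add_assoc]; simp only [tri, ih]; ring

section part1
variable {R : Type*} [CommRing R]

/-- Summand of the Rogers series. -/
def T (q : R) (k r : ℕ) : R :=
  (-1) ^ r * q ^ (2 * r * (k + 1) + (5 * tri r + 2 * r)) * (1 - q ^ (2 * r + k + 1)) *
    ∏ i ∈ range k, (1 - q ^ (r + 1 + i))

/-- Telescoping certificate. -/
def U (q : R) (k r : ℕ) : R :=
  (-1) ^ r * q ^ (2 * r * (k + 1) + (5 * tri r + 2 * r)) *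
    (-1 - q ^ r + q ^ (2 * r + k + 1)) * ∏ i ∈ range (k + 1), (1 - q ^ (r + i))

lemma T_rec (q : R) (k r : ℕ) :
    T q k r - T q (k + 1) r - q ^ (k + 2) * T q (k + 2) r = U q k (r + 1) - U q k r := by
  have h1 : ∏ i ∈ range (k + 1), (1 - q ^ (r + i)) =
      (1 - q ^ r) * ∏ i ∈ range k, (1 - q ^ (r + 1 + i)) := by
    rw [prod_range_succ', mul_comm]
    simp only [add_zero]
    congr 1
    apply prod_congr rfl
    intro i _
    congr 2; ring
  simp only [T, U, h1, prod_range_succ, tri]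
  generalize ∏ i ∈ range k, (1 - q ^ (r + 1 + i)) = Q
  have e1 : 2 * r * (k + 1 + 1) + (5 * tri r + 2 * r)
    = (2 * r * (k + 1) + (5 * tri r + 2 * r)) + r + r := by ring
  have e2 : 2 * r * (k + 2 + 1) + (5 * tri r + 2 * r)
    = (2 * r * (k + 1) + (5 * tri r + 2 * r)) + r + r + r + r := by ring
  have e3 : 2 * (r + 1) * (k + 1) + (5 * (tri r + r) + 2 * (r + 1))
    = (2 * r * (k + 1) + (5 * tri r + 2 * r)) + k + k + r + r + r + r + r + 4 := by ring
  rw [e1, e2, e3]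
  generalize 2 * r * (k + 1) + (5 * tri r + 2 * r) = e
  have e4 : 2 * r + k + 1 = r + r + k + 1 := by ring
  have e5 : 2 * r + (k + 1) + 1 = r + r + k + 2 := by ring
  have e6 : 2 * r + (k + 2) + 1 = r + r + k + 3 := by ring
  have e7 : 2 * (r + 1) + k + 1 = r + r + k + 3 := by ring
  rw [e4, e5, e6, e7]
  simp only [pow_add]
  generalize q ^ e = A
  generalize q ^ r = b
  generalize q ^ k = c
  ring

variable {q : R} {M : ℕ}

lemma pow_zero_of_le (hq : q ^ M = 0) {n : ℕ} (h : M ≤ n) : q ^ n = 0 := pow_eq_zero_of_le h hq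

lemma P_rec (hq : q ^ M = 0) (k L : ℕ) (hL : M ≤ L) :
    ∑ r ∈ range L, T q k r = ∑ r ∈ range L, T q (k + 1) r +
      q ^ (k + 2) * ∑ r ∈ range L, T q (k + 2) r := by
  have h : ∑ r ∈ range L, (T q k r - T q (k + 1) r - q ^ (k + 2) * T q (k + 2) r) = 0 := by
    simp only [T_rec]
    rw [sum_range_sub]
    have h0 : U q k 0 = 0 := by
      simp [U, prod_range_succ']
    have h1 : U q k L = 0 := by
      rw [U, pow_zero_of_le hq (by nlinarith : M ≤ 2 * L * (k + 1) + (5 * tri L + 2 * L))]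
      ring
    rw [h0, h1, sub_zero]
  rw [sum_sub_distrib, sum_sub_distrib, ← mul_sum] at h
  linear_combination h

lemma prod_stab (hq : q ^ M = 0) (f : ℕ → ℕ) (hf : ∀ i, i < f i) {a b : ℕ} (ha : M ≤ a) (hb : M ≤ b) :
    ∏ i ∈ range a, (1 - q ^ f i) = ∏ i ∈ range b, (1 - q ^ f i) := by
  have key : ∀ a, M ≤ a → ∏ i ∈ range a, (1 - q ^ f i) = ∏ i ∈ range M, (1 - q ^ f i) := by
    intro a ha
    induction a, ha using Nat.le_induction with
    | base => rfl
    | succ n hn ih =>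
      rw [prod_range_succ, ih, pow_zero_of_le hq (by have := hf n; omega)]; simp
  rw [key a ha, key b hb]

lemma P_large (hq : q ^ M = 0) (k L b : ℕ) (hL0 : 0 < L) (hk : M ≤ k) (hb : M ≤ b) :
    ∑ r ∈ range L, T q k r = ∏ i ∈ range b, (1 - q ^ (i + 1)) := by
  rw [sum_eq_single_of_mem 0 (by simpa using hL0)]
  · rw [← prod_stab hq (fun i => i + 1) (by simp) hk hb]
    simp only [T, tri]
    rw [pow_zero_of_le hq (by omega : M ≤ 2 * 0 + k + 1)]
    simp [add_comm]
  · intro r _ hr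
    rw [T, pow_zero_of_le hq (by nlinarith [Nat.pos_of_ne_zero hr] : M ≤ 2 * r * (k + 1) + (5 * tri r + 2 * r))]
    ring

/-- Uniqueness of solutions of the recurrence. -/
lemma uniq (F : ℕ → R) (h : ∀ k, F k = F (k + 1) + q ^ (k + 2) * F (k + 2))
    (h0 : ∀ k, M ≤ k → F k = 0) (k : ℕ) : F k = 0 := by
  have key : ∀ d k, M ≤ k + d → F k = 0 := by
    intro d
    induction d with
    | zero => intro k hk; exact h0 k hk
    | succ d ih =>
      intro k hk
      rw [h, ih (k + 1) (by omega), ih (k + 2) (by omega)]; simp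
  exact key M k (by omega)

lemma unit_prod (hq : q ^ M = 0) (f : ℕ → ℕ) (hf : ∀ i, i < f i) (a : ℕ) :
    IsUnit (∏ i ∈ range a, (1 - q ^ f i)) := by
  rw [IsUnit.prod_iff]
  intro i _
  apply IsNilpotent.isUnit_one_sub
  exact ⟨M, by rw [← pow_mul, mul_comm, pow_mul, hq, zero_pow]; have := hf i; omega⟩
end part1

section gauss
variable {R : Type*} [CommRing R]

/-- Gaussian binomials by the Pascal recursion. -/
def G (p : R) : ℕ → ℕ → R
  | _, 0 => 1
  | 0, _ + 1 => 0
  | n + 1, k + 1 => p ^ (k + 1) * G p n (k + 1) + G p n k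

lemma G_zero (p : R) (n : ℕ) : G p n 0 = 1 := by cases n <;> rfl
lemma G_succ (p : R) (n k : ℕ) :
    G p (n + 1) (k + 1) = p ^ (k + 1) * G p n (k + 1) + G p n k := rfl

lemma G_gt (p : R) (n k : ℕ) (h : n < k) : G p n k = 0 := by
  induction n generalizing k with
  | zero => obtain ⟨k, rfl⟩ := Nat.exists_eq_add_one_of_ne_zero (by omega : k ≠ 0); rfl
  | succ n ih =>
    obtain ⟨k, rfl⟩ := Nat.exists_eq_add_one_of_ne_zero (by omega : k ≠ 0)
    rw [G_succ, ih _ (by omega), ih _ (by omega)]; simp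

lemma G_self (p : R) (n : ℕ) : G p n n = 1 := by
  induction n with
  | zero => rfl
  | succ n ih => rw [G_succ, G_gt _ _ _ (by omega), ih]; simp

lemma G_map {S : Type*} [CommRing S] (f : R →+* S) (p : R) (n k : ℕ) :
    f (G p n k) = G (f p) n k := by
  induction n generalizing k with
  | zero => cases k <;> simp [G]
  | succ n ih => cases k <;> simp [G_zero, G_succ, ih]

/-- `(p;p)_a`. -/
def poch (p : R) (a : ℕ) : R := ∏ i ∈ range a, (1 - p ^ (i + 1))

lemma G_formula (p : R) (a b : ℕ) : G p (a + b) a * (poch p a * poch p b) = poch p (a + b) := by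
  induction h : a + b generalizing a b with
  | zero =>
    obtain ⟨rfl, rfl⟩ : a = 0 ∧ b = 0 := by omega
    simp [G_zero, poch]
  | succ n ih =>
    rcases a with _ | a
    · obtain rfl : b = n + 1 := by omega
      simp [G_zero, poch]
    rcases b with _ | b
    · obtain rfl : a = n := by omega
      simp [G_self, poch]
    have h1 := ih (a + 1) b (by omega)
    have h2 := ih a (b + 1) (by omega)
    obtain rfl : n = a + b + 1 := by omega
    rw [G_succ]
    have ea : poch p (a + 1) = poch p a * (1 - p ^ (a + 1)) := prod_range_succ _ _
    have eb : poch p (b + 1) = poch p b * (1 - p ^ (b + 1)) := prod_range_succ _ _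
    have en : poch p (a + b + 1 + 1) = poch p (a + b + 1) * (1 - p ^ (a + b + 1 + 1)) :=
      prod_range_succ _ _
    rw [en]
    calc _ = p ^ (a + 1) * (1 - p ^ (b + 1)) * (G p (a + b + 1) (a + 1) * (poch p (a + 1) * poch p b))
          + (1 - p ^ (a + 1)) * (G p (a + b + 1) a * (poch p a * poch p (b + 1))) := by
          rw [ea, eb]; ring
      _ = _ := by rw [h1, h2]; ring

lemma qbinom (p x y : R) (n : ℕ) :
    ∏ i ∈ range n, (y + x * p ^ i) =
      ∑ k ∈ range (n + 1), p ^ tri k * G p n k * x ^ k * y ^ (n - k) := by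
  induction n generalizing x with
  | zero => simp [tri, G]
  | succ n ih =>
    rw [prod_range_succ']
    have : ∀ i, y + x * p ^ (i + 1) = y + (x * p) * p ^ i := fun i => by ring
    simp only [this, ih]
    rw [sum_range_succ' _ (n + 1)]
    simp only [G_succ, tri, G_zero]
    have hy : y * ∑ k ∈ range (n + 1), p ^ tri k * G p n k * (x * p) ^ k * y ^ (n - k)
        = ∑ k ∈ range (n + 1),
          p ^ (tri k + k) * (p ^ (k + 1) * G p n (k + 1)) * x ^ (k + 1) * y ^ (n - k)
          + y ^ (n + 1) := by
      have h2 : ∑ k ∈ range (n + 2), p ^ tri k * G p n k * (x * p) ^ k * y ^ (n + 1 - k) =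
          ∑ k ∈ range (n + 1), p ^ tri k * G p n k * (x * p) ^ k * y ^ (n + 1 - k) := by
        rw [sum_range_succ _ (n + 1), G_gt p n (n + 1) (by omega)]; simp
      rw [mul_sum]
      trans ∑ k ∈ range (n + 1), p ^ tri k * G p n k * (x * p) ^ k * y ^ (n + 1 - k)
      · apply sum_congr rfl
        intro k hk
        rw [Nat.sub_add_comm (by simp at hk; omega), pow_succ]; ring
      · rw [← h2, sum_range_succ' _ (n + 1)]
        congr 1
        · apply sum_congr rfl
          intro k _
          rw [Nat.add_sub_add_right, tri, mul_pow]; ring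
        · simp [tri, G_zero]
    have hx : x * ∑ k ∈ range (n + 1), p ^ tri k * G p n k * (x * p) ^ k * y ^ (n - k)
        = ∑ k ∈ range (n + 1),
          p ^ (tri k + k) * G p n k * x ^ (k + 1) * y ^ (n - k) := by
      rw [mul_sum]
      apply sum_congr rfl
      intro k _
      rw [mul_pow]; ring
    simp only [Nat.add_sub_add_right, mul_add, add_mul, sum_add_distrib]
    rw [pow_zero, mul_one, mul_comm _ y, mul_comm _ x, hy, hx]
    simp only [pow_zero, Nat.sub_zero, mul_one, one_mul]
    ring

/-- Finite Jacobi triple product, before cancelling the common power. -/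
lemma fin_jtp_aux (q : R) (N : ℕ) :
    q ^ (5 * N * (N + 1) + N + 5 * tri N) *
      ((∏ i ∈ range N, (1 - q ^ (5 * i + 4))) * ∏ i ∈ range (N + 1), (1 - q ^ (5 * i + 1))) =
    q ^ (5 * N * (N + 1) + N + 5 * tri N) *
      ∑ r ∈ range (N + 1), (-1) ^ r * q ^ (5 * tri r + 4 * r) *
        (G (q ^ 5) (2 * N + 1) (N - r) - q ^ (2 * r + 1) * G (q ^ 5) (2 * N + 1) (N + 1 + r)) := by
  have hb := qbinom (q ^ 5) (-q) (q ^ (5 * N)) (2 * N + 1)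
  have h1 : ∏ i ∈ range (2 * N + 1), (q ^ (5 * N) + -q * (q ^ 5) ^ i) =
      (-1) ^ N * (q ^ (5 * N * (N + 1) + N + 5 * tri N) *
      ((∏ i ∈ range N, (1 - q ^ (5 * i + 4))) * ∏ i ∈ range (N + 1), (1 - q ^ (5 * i + 1)))) := by
    rw [(by ring : 2 * N + 1 = N + (N + 1)), prod_range_add]
    have ha : ∏ i ∈ range (N + 1), (q ^ (5 * N) + -q * (q ^ 5) ^ (N + i)) =
        q ^ (5 * N * (N + 1)) * ∏ i ∈ range (N + 1), (1 - q ^ (5 * i + 1)) := by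
      have hz : q ^ (5 * N * (N + 1)) = ∏ _i ∈ range (N + 1), q ^ (5 * N) := by
        rw [prod_const, card_range, ← pow_mul]
      rw [hz, ← prod_mul_distrib]
      apply prod_congr rfl
      intro i _
      ring
    have hp : ∏ i ∈ range N, (-1 * q ^ (5 * i + 1)) = (-1) ^ N * q ^ (N + 5 * tri N) := by
      clear hb ha
      induction N with
      | zero => simp [tri]
      | succ n ih => rw [prod_range_succ, ih, tri]; ring
    have hc : ∏ i ∈ range N, (q ^ (5 * N) + -q * (q ^ 5) ^ i) =
        (-1) ^ N * q ^ (N + 5 * tri N) * ∏ i ∈ range N, (1 - q ^ (5 * i + 4)) := by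
      rw [← hp, ← prod_range_reflect (fun i => 1 - q ^ (5 * i + 4)), ← prod_mul_distrib]
      apply prod_congr rfl
      intro i hi
      obtain ⟨m, rfl⟩ : ∃ m, N = i + 1 + m := ⟨N - 1 - i, by simp at hi; omega⟩
      rw [(by omega : i + 1 + m - 1 - i = m)]
      ring
    rw [ha, hc]; ring
  have h2 : ∑ k ∈ range (2 * N + 1 + 1), (q ^ 5) ^ tri k * G (q ^ 5) (2 * N + 1) k * (-q) ^ k *
        (q ^ (5 * N)) ^ (2 * N + 1 - k) =
      (-1) ^ N * (q ^ (5 * N * (N + 1) + N + 5 * tri N) *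
      ∑ r ∈ range (N + 1), (-1) ^ r * q ^ (5 * tri r + 4 * r) *
        (G (q ^ 5) (2 * N + 1) (N - r) -
          q ^ (2 * r + 1) * G (q ^ 5) (2 * N + 1) (N + 1 + r))) := by
    rw [(by ring : 2 * N + 1 + 1 = (N + 1) + (N + 1)), sum_range_add, ← sum_range_reflect,
      ← sum_add_distrib, mul_sum, mul_sum]
    apply sum_congr rfl
    intro r hr
    obtain ⟨m, rfl⟩ : ∃ m, N = m + r := ⟨N - r, by simp at hr; omega⟩
    rw [(by omega : m + r + 1 - 1 - r = m), (by omega : m + r - r = m),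
      (by omega : 2 * (m + r) + 1 - m = m + 2 * r + 1),
      (by omega : 2 * (m + r) + 1 - (m + r + 1 + r) = m)]
    have t1 := two_tri r
    have t2 := tri_add m r
    have t3 : tri (m + r + 1 + r) = tri (m + r) + (m + r) + tri r + (m + r + 1) * r := by
      rw [tri_add, tri]
    generalize G (q ^ 5) (2 * (m + r) + 1) m = g1
    generalize G (q ^ 5) (2 * (m + r) + 1) (m + r + 1 + r) = g2
    have hs : ((-1 : R) ^ r) * (-1) ^ r = 1 := by rw [← mul_pow]; simp
    have E1 : 5 * tri m + m + 5 * (m + r) * (m + 2 * r + 1) =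
      5 * (m + r) * (m + r + 1) + (m + r) + 5 * tri (m + r) + (5 * tri r + 4 * r) := by
      rw [t2]; nlinarith
    have E2 : 5 * tri (m + r + 1 + r) + (m + r + 1 + r) + 5 * (m + r) * m =
      5 * (m + r) * (m + r + 1) + (m + r) + 5 * tri (m + r) + (5 * tri r + 4 * r) + (2 * r + 1) := by
      rw [t3]; nlinarith
    have F1 : (q ^ 5) ^ tri m * g1 * (-q) ^ m * (q ^ (5 * (m + r))) ^ (m + 2 * r + 1) =
      (-1) ^ m * g1 * q ^ (5 * tri m + m + 5 * (m + r) * (m + 2 * r + 1)) := by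
      rw [neg_pow q m]; ring
    have F2 : (q ^ 5) ^ tri (m + r + 1 + r) * g2 * (-q) ^ (m + r + 1 + r) *
        (q ^ (5 * (m + r))) ^ m =
      (-1) ^ (m + r + 1 + r) * g2 *
        q ^ (5 * tri (m + r + 1 + r) + (m + r + 1 + r) + 5 * (m + r) * m) := by
      rw [neg_pow q (m + r + 1 + r)]; ring
    rw [F1, F2, E1, E2]
    rw [pow_add _ (5 * (m + r) * (m + r + 1) + (m + r) + 5 * tri (m + r) + (5 * tri r + 4 * r))
      (2 * r + 1), pow_add _ (5 * (m + r) * (m + r + 1) + (m + r) + 5 * tri (m + r))]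
    generalize q ^ (5 * (m + r) * (m + r + 1) + (m + r) + 5 * tri (m + r)) = A
    generalize q ^ (5 * tri r + 4 * r) = B
    generalize q ^ (2 * r + 1) = C
    simp only [pow_add, pow_one]
    linear_combination (-(-1) ^ m * g1 * A * B) * hs
  rw [h1, h2] at hb
  have hu : IsUnit ((-1 : R) ^ N) := (isUnit_one.neg).pow N
  exact hu.mul_left_cancel hb

lemma fin_jtp (N : ℕ) :
    ((∏ i ∈ range N, (1 - (PowerSeries.X : PowerSeries ℤ) ^ (5 * i + 4))) *
      ∏ i ∈ range (N + 1), (1 - PowerSeries.X ^ (5 * i + 1))) =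
      ∑ r ∈ range (N + 1), (-1) ^ r * PowerSeries.X ^ (5 * tri r + 4 * r) *
        (G (PowerSeries.X ^ 5) (2 * N + 1) (N - r) -
          PowerSeries.X ^ (2 * r + 1) * G (PowerSeries.X ^ 5) (2 * N + 1) (N + 1 + r)) :=
  mul_left_cancel₀ (pow_ne_zero _ PowerSeries.X_ne_zero) (fin_jtp_aux _ N)

lemma jtp_mod (f : PowerSeries ℤ →+* R) (q : R) (hf : f PowerSeries.X = q) (M : ℕ)
    (hq : q ^ M = 0) (N : ℕ) (hN : 2 * M ≤ N) (hM : 0 < M) :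
    (∏ i ∈ range N, (1 - q ^ (5 * i + 5))) * ((∏ i ∈ range N, (1 - q ^ (5 * i + 4))) *
      ∏ i ∈ range N, (1 - q ^ (5 * i + 1))) = ∑ r ∈ range N, T q 0 r := by
  have h := congrArg f (fin_jtp N)
  simp only [map_mul, map_prod, map_sub, map_sum, map_pow, map_one, map_neg, hf, G_map] at h
  rw [prod_stab hq (fun i => 5 * i + 1) (by intro i; simp; omega) (by omega : M ≤ N)
    (by omega : M ≤ N + 1), h, mul_sum, sum_range_succ]
  have hp : ∀ a, poch (q ^ 5) a = ∏ i ∈ range a, (1 - q ^ (5 * i + 5)) := by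
    intro a
    apply prod_congr rfl
    intro i _
    rw [← pow_mul]; ring
  have hG : ∀ a b, M ≤ a → M ≤ b → (∏ i ∈ range N, (1 - q ^ (5 * i + 5))) *
      G (q ^ 5) (a + b) a = 1 := by
    intro a b ha hb
    have h5 : ∀ i, i < 5 * i + 5 := by intro i; omega
    have hh := G_formula (q ^ 5) a b
    rw [hp, hp, hp, prod_stab hq (fun i => 5 * i + 5) h5 ha (by omega : M ≤ N),
      prod_stab hq (fun i => 5 * i + 5) h5 hb (by omega : M ≤ N),
      prod_stab hq (fun i => 5 * i + 5) h5 (by omega : M ≤ a + b) (by omega : M ≤ N)] at hh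
    have hu := unit_prod hq (fun i => 5 * i + 5) h5 N
    apply hu.mul_left_cancel
    rw [mul_one]
    linear_combination hh
  rw [pow_zero_of_le hq (by omega : M ≤ 5 * tri N + 4 * N)]
  simp only [mul_zero, zero_mul, add_zero]
  apply sum_congr rfl
  intro r hr
  have hr' : r < N := by simpa using hr
  by_cases hrM : M ≤ r
  · rw [T, pow_zero_of_le hq (by omega : M ≤ 5 * tri r + 4 * r),
      pow_zero_of_le hq (by nlinarith : M ≤ 2 * r * (0 + 1) + (5 * tri r + 2 * r))]
    ring
  · have g1 := hG (N - r) (N + 1 + r) (by omega) (by omega)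
    have g2 := hG (N + 1 + r) (N - r) (by omega) (by omega)
    rw [(by omega : N - r + (N + 1 + r) = 2 * N + 1)] at g1
    rw [(by omega : N + 1 + r + (N - r) = 2 * N + 1)] at g2
    rw [T, (by ring : 2 * r * (0 + 1) + (5 * tri r + 2 * r) = 5 * tri r + 4 * r)]
    simp only [range_zero, prod_empty, mul_one, add_zero]
    linear_combination (-1) ^ r * q ^ (5 * tri r + 4 * r) * g1 -
      (-1) ^ r * q ^ (5 * tri r + 4 * r) * q ^ (2 * r + 1) * g2
end gauss

/-- Lists with successive gaps at least two, entries at least `k`, and sum `n`. -/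
def D (k n : ℕ) : Set (List ℕ) :=
  {l | l.IsChain (fun a b => a + 2 ≤ b) ∧ (∀ a ∈ l, k ≤ a) ∧ l.sum = n}

lemma chain_pairwise {l : List ℕ} (h : l.IsChain (fun a b => a + 2 ≤ b)) :
    l.Pairwise (fun a b => a + 2 ≤ b) := by
  have : IsTrans ℕ (fun a b => a + 2 ≤ b) := ⟨fun a b c h1 h2 => by omega⟩
  exact List.isChain_iff_pairwise.1 h

lemma chain_iff {l : List ℕ} : l.IsChain (fun a b => a + 2 ≤ b) ↔
    l.Pairwise (fun a b => a + 2 ≤ b) := ⟨chain_pairwise, fun h => h.isChain⟩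

lemma D_large (k n : ℕ) (h : n < k) : D k n = if n = 0 then {[]} else ∅ := by
  ext l
  rcases l with _ | ⟨a, l⟩
  · simp only [D, Set.mem_ofPred_eq]
    split_ifs with h0 <;> simp [h0, eq_comm]
  · simp only [D, Set.mem_ofPred_eq, List.sum_cons, List.mem_cons]
    constructor
    · rintro ⟨-, h1, h2⟩
      have := h1 a (Or.inl rfl)
      omega
    · split_ifs <;> simp

lemma D_rec (k n : ℕ) : D k n = D (k + 1) n ∪
    (if k ≤ n then Set.image (List.cons k) (D (k + 2) (n - k)) else ∅) := by
  ext l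
  rcases l with _ | ⟨a, l⟩
  · split_ifs <;> simp [D]
  · have e : a :: l ∈ (if k ≤ n then Set.image (List.cons k) (D (k + 2) (n - k)) else ∅) ↔
        k ≤ n ∧ a = k ∧ l ∈ D (k + 2) (n - k) := by
      split_ifs with h <;> simp [h]; tauto
    rw [Set.mem_union, e]
    simp only [D, Set.mem_ofPred_eq, chain_iff, List.pairwise_cons, List.mem_cons, List.sum_cons,
      forall_eq_or_imp]
    constructor
    · rintro ⟨⟨h1, h2⟩, ⟨h3, h4⟩, h5⟩
      rcases Nat.eq_or_lt_of_le h3 with rfl | h6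
      · right
        exact ⟨by omega, rfl, h2, h1, by omega⟩
      · left
        exact ⟨⟨h1, h2⟩, ⟨h6, fun b hb => by have := h1 b hb; omega⟩, h5⟩
    · rintro (⟨⟨h1, h2⟩, ⟨h3, h4⟩, h5⟩ | ⟨h1, rfl, h2, h3, h4⟩)
      · exact ⟨⟨h1, h2⟩, ⟨by omega, fun b hb => by have := h4 b hb; omega⟩, h5⟩
      · exact ⟨⟨h3, h2⟩, ⟨le_refl _, fun b hb => by have := h3 b hb; omega⟩, by omega⟩

lemma D_finite (k n : ℕ) : (D k n).Finite := by
  have key : ∀ d k n, n < k + d → (D k n).Finite := by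
    intro d
    induction d with
    | zero =>
      intro k n h
      rw [D_large k n (by omega)]; split_ifs <;> simp
    | succ d ih =>
      intro k n h
      rw [D_rec]
      refine (ih (k + 1) n (by omega)).union ?_
      split_ifs
      · exact (ih (k + 2) (n - k) (by omega)).image _
      · simp
  exact key (n + 1) k n (by omega)

lemma D_card_rec (k n : ℕ) : (D k n).ncard = (D (k + 1) n).ncard +
    if k ≤ n then (D (k + 2) (n - k)).ncard else 0 := by
  rw [D_rec]
  split_ifs with h
  · rw [Set.ncard_union_eq _ (D_finite _ _) ((D_finite _ _).image _),
      Set.ncard_image_of_injective _ (List.cons_injective)]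
    rw [Set.disjoint_left]
    rintro l h1 ⟨l', -, rfl⟩
    have := h1.2.1 k (by simp)
    omega
  · simp

/-- Generating function of gap-two lists. -/
noncomputable def Dser (k : ℕ) : PowerSeries ℤ := PowerSeries.mk fun n => ((D k n).ncard : ℤ)

lemma Dser_rec (k : ℕ) : Dser k = Dser (k + 1) + PowerSeries.X ^ k * Dser (k + 2) := by
  ext n
  simp only [Dser, map_add, PowerSeries.coeff_mk, PowerSeries.coeff_X_pow_mul']
  rw [D_card_rec]
  push_cast
  rfl

lemma Dser_large (M k : ℕ) (h : M ≤ k) : (PowerSeries.X ^ M : PowerSeries ℤ) ∣ Dser k - 1 := by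
  rw [PowerSeries.X_pow_dvd_iff]
  intro m hm
  rw [map_sub, Dser, PowerSeries.coeff_mk, D_large k m (by omega), PowerSeries.coeff_one]
  split_ifs <;> simp

lemma card_eq_D (n : ℕ) : Nat.card {p : n.Partition //
      ((p.parts.sort (· ≤ ·)).Chain' fun a b => a + 2 ≤ b) ∧ ∀ a ∈ p.parts, 2 ≤ a} =
      (D 2 n).ncard := by
  rw [← Nat.card_coe_set_eq]
  apply Nat.card_congr
  refine ⟨fun p => ⟨p.1.parts.sort (· ≤ ·), p.2.1, fun a ha => p.2.2 a (by simpa using ha), ?_⟩,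
    fun l => ⟨⟨(l.1 : Multiset ℕ), fun {i} hi => ?_, ?_⟩, ?_, ?_⟩, ?_, ?_⟩
  · rw [← Multiset.sum_coe, Multiset.sort_eq, p.1.parts_sum]
  · have := l.2.2.1 i (by simpa using hi)
    omega
  · rw [Multiset.sum_coe]; exact l.2.2.2
  · have hs : (l.1 : Multiset ℕ).sort (· ≤ ·) = l.1 := by
      rw [Multiset.coe_sort]
      apply List.mergeSort_eq_self
      exact (chain_pairwise l.2.1).imp (by intro a b h; omega)
    show List.IsChain _ _
    rw [hs]; exact l.2.1
  · intro a ha; exact l.2.2.1 a (by simpa using ha)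
  · intro p
    apply Subtype.ext
    apply Nat.Partition.ext
    simp
  · intro l
    apply Subtype.ext
    show (l.1 : Multiset ℕ).sort (· ≤ ·) = l.1
    rw [Multiset.coe_sort]
    apply List.mergeSort_eq_self
    exact (chain_pairwise l.2.1).imp (by intro a b h; omega)

/-- Generating function of partitions into parts 2, 3 mod 5. -/
noncomputable def Cser : PowerSeries ℤ := PowerSeries.mk fun n =>
  ((Nat.Partition.restricted n (fun a => a % 5 = 2 ∨ a % 5 = 3)).card : ℤ)

lemma card_eq_C (n : ℕ) : Nat.card {p : n.Partition // ∀ a ∈ p.parts, a % 5 = 2 ∨ a % 5 = 3} =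
    (Nat.Partition.restricted n (fun a => a % 5 = 2 ∨ a % 5 = 3)).card := by
  rw [Nat.card_eq_fintype_card, Fintype.card_subtype]
  rfl

open PowerSeries PowerSeries.WithPiTopology in
lemma Cser_prod (M : ℕ) : ∃ N0, ∀ N, N0 ≤ N → (PowerSeries.X ^ M : PowerSeries ℤ) ∣
    Cser * (∏ i ∈ range N, (if (i + 1) % 5 = 2 ∨ (i + 1) % 5 = 3 then
      (1 - PowerSeries.X ^ (i + 1)) else 1)) - 1 := by
  have h := (Nat.Partition.hasProd_powerSeriesMk_card_restricted ℤ
    (fun a => a % 5 = 2 ∨ a % 5 = 3)).tendsto_prod_nat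
  rw [tendsto_iff_coeff_tendsto] at h
  have h2 : ∀ᶠ N in Filter.atTop, ∀ m ∈ range M, coeff m (∏ i ∈ range N,
      if (i + 1) % 5 = 2 ∨ (i + 1) % 5 = 3 then ∑' j : ℕ, (X : PowerSeries ℤ) ^ ((i + 1) * j) else 1) =
        coeff m Cser := by
    rw [Filter.eventually_all_finset]
    intro m _
    have := h m
    rw [nhds_discrete, Filter.tendsto_pure] at this
    exact this
  obtain ⟨N0, hN0⟩ := Filter.eventually_atTop.1 h2
  refine ⟨N0, fun N hN => ?_⟩
  have h3 := hN0 N hN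
  have h4 : (X ^ M : PowerSeries ℤ) ∣ Cser - ∏ i ∈ range N,
      if (i + 1) % 5 = 2 ∨ (i + 1) % 5 = 3 then ∑' j : ℕ, (X : PowerSeries ℤ) ^ ((i + 1) * j) else 1 := by
    rw [X_pow_dvd_iff]
    intro m hm
    rw [map_sub, h3 m (by simpa using hm), sub_self]
  have h5 : (∏ i ∈ range N,
      if (i + 1) % 5 = 2 ∨ (i + 1) % 5 = 3 then ∑' j : ℕ, (X : PowerSeries ℤ) ^ ((i + 1) * j) else 1) *
      (∏ i ∈ range N, (if (i + 1) % 5 = 2 ∨ (i + 1) % 5 = 3 then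
      (1 - PowerSeries.X ^ (i + 1)) else 1)) = 1 := by
    rw [← prod_mul_distrib]
    apply prod_eq_one
    intro i _
    split_ifs
    · simp_rw [pow_mul]
      exact tsum_pow_mul_one_sub_of_constantCoeff_eq_zero (by simp)
    · simp
  have h6 := h4.mul_right (∏ i ∈ range N, (if (i + 1) % 5 = 2 ∨ (i + 1) % 5 = 3 then
      (1 - PowerSeries.X ^ (i + 1)) else 1))
  rwa [sub_mul, h5] at h6

lemma prod_five {R : Type*} [CommRing R] (f : ℕ → R) (L : ℕ) :
    ∏ i ∈ range (5 * L), f i =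
      ∏ i ∈ range L, (f (5 * i) * f (5 * i + 1) * f (5 * i + 2) * f (5 * i + 3) * f (5 * i + 4)) := by
  induction L with
  | zero => simp
  | succ L ih =>
    rw [prod_range_succ, ← ih, (by ring : 5 * (L + 1) = 5 * L + 1 + 1 + 1 + 1 + 1)]
    rw [prod_range_succ, prod_range_succ, prod_range_succ, prod_range_succ, prod_range_succ]
    simp only [mul_assoc]

lemma main_mod (M : ℕ) (hM : 0 < M) : (PowerSeries.X ^ M : PowerSeries ℤ) ∣ Cser - Dser 2 := by
  let f := Ideal.Quotient.mk (Ideal.span {(PowerSeries.X ^ M : PowerSeries ℤ)})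
  have hf : ∀ x, f x = 0 ↔ PowerSeries.X ^ M ∣ x := fun x => by
    rw [Ideal.Quotient.eq_zero_iff_mem, Ideal.mem_span_singleton]
  obtain ⟨q, hfq⟩ : ∃ q, f PowerSeries.X = q := ⟨_, rfl⟩
  have hq : q ^ M = 0 := by rw [← hfq, ← map_pow, hf]
  obtain ⟨N0, hN0⟩ := Cser_prod M
  obtain ⟨L, hL1, hL2⟩ : ∃ L, 2 * M ≤ L ∧ N0 ≤ L := ⟨2 * M + N0, by omega, by omega⟩
  have hC := (hf _).2 (hN0 (5 * L) (by omega))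
  rw [map_sub, map_mul, map_one, map_prod, prod_five, sub_eq_zero] at hC
  have hB : ∀ i, f (if (5 * i + 1) % 5 = 2 ∨ (5 * i + 1) % 5 = 3 then
      (1 - PowerSeries.X ^ (5 * i + 1)) else 1) *
      f (if (5 * i + 1 + 1) % 5 = 2 ∨ (5 * i + 1 + 1) % 5 = 3 then
      (1 - PowerSeries.X ^ (5 * i + 1 + 1)) else 1) *
      f (if (5 * i + 2 + 1) % 5 = 2 ∨ (5 * i + 2 + 1) % 5 = 3 then
      (1 - PowerSeries.X ^ (5 * i + 2 + 1)) else 1) *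
      f (if (5 * i + 3 + 1) % 5 = 2 ∨ (5 * i + 3 + 1) % 5 = 3 then
      (1 - PowerSeries.X ^ (5 * i + 3 + 1)) else 1) *
      f (if (5 * i + 4 + 1) % 5 = 2 ∨ (5 * i + 4 + 1) % 5 = 3 then
      (1 - PowerSeries.X ^ (5 * i + 4 + 1)) else 1) =
      (1 - q ^ (5 * i + 2)) * (1 - q ^ (5 * i + 3)) := by
    intro i
    rw [if_neg (by omega), if_pos (by omega), if_pos (by omega), if_neg (by omega),
      if_neg (by omega)]
    simp only [map_sub, map_one, map_pow, hfq]
    ring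
  simp only [hB] at hC
  -- the recurrence
  have hD : ∀ k, f (Dser k) = f (Dser (k + 1)) + q ^ k * f (Dser (k + 2)) := by
    intro k
    rw [← hfq, ← map_pow, ← map_mul, ← map_add, ← Dser_rec]
  have hD1 : ∀ k, M ≤ k → f (Dser k) = 1 := by
    intro k hk
    have := (hf _).2 (Dser_large M k hk)
    rwa [map_sub, map_one, sub_eq_zero] at this
  have hu := uniq (q := q) (M := M) (fun k => (∏ i ∈ range (5 * L), (1 - q ^ (i + 1))) * f (Dser (k + 2)) -
    ∑ r ∈ range L, T q k r) (by
      intro k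
      have h1 := hD (k + 2)
      have h2 := P_rec hq k L (by omega)
      show _ - _ = (_ - _) + _ * (_ - _)
      rw [h1, h2, (by ring : k + 2 + 1 = k + 1 + 2)]
      ring) (by
      intro k hk
      show _ - _ = _
      rw [hD1 (k + 2) (by omega), P_large hq k L (5 * L) (by omega) hk (by omega)]
      ring) 0
  have hu' : (∏ i ∈ range (5 * L), (1 - q ^ (i + 1))) * f (Dser 2) = ∑ r ∈ range L, T q 0 r :=
    sub_eq_zero.1 hu
  rw [← jtp_mod f q hfq M hq L hL1 hM, prod_five] at hu'
  simp only [prod_mul_distrib] at hu' hC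
  have u1 := unit_prod hq (fun i => 5 * i + 1) (by intro i; omega) L
  have u4 := unit_prod hq (fun i => 5 * i + 4) (by intro i; omega) L
  have u5 := unit_prod hq (fun i => 5 * i + 5) (by intro i; omega) L
  simp only [add_assoc, Nat.reduceAdd] at hu'
  have hfin : ((∏ i ∈ range L, (1 - q ^ (5 * i + 2))) * ∏ i ∈ range L, (1 - q ^ (5 * i + 3))) *
      f (Dser 2) = 1 := by
    apply (u5.mul (u4.mul u1)).mul_left_cancel
    rw [mul_one]
    linear_combination hu'
  rw [← hf, map_sub, sub_eq_zero]
  linear_combination f (Dser 2) * hC - f Cser * hfin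
end RR

/-- second Rogers–Ramanujan identity, combinatorial form.
For every nonnegative integer `n`, the number of partitions of `n` whose parts are all
congruent to `2` or `3` modulo `5` equals the number of partitions `b₁ ≥ b₂ ≥ ⋯ ≥ b_s`
of `n` with `b_j − b_{j+1} ≥ 2` for all `1 ≤ j < s` and with smallest part `b_s ≥ 2`. -/
theorem statement6 (n : ℕ) :
    Nat.card {p : n.Partition // ∀ a ∈ p.parts, a % 5 = 2 ∨ a % 5 = 3} =
    Nat.card {p : n.Partition //
      ((p.parts.sort (· ≤ ·)).Chain' fun a b => a + 2 ≤ b) ∧ ∀ a ∈ p.parts, 2 ≤ a} := by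
  rw [RR.card_eq_C, RR.card_eq_D]
  have h := PowerSeries.X_pow_dvd_iff.1 (RR.main_mod (n + 1) (by omega)) n (by omega)
  rw [map_sub, RR.Cser, RR.Dser, PowerSeries.coeff_mk, PowerSeries.coeff_mk, sub_eq_zero] at h
  exact_mod_cast h
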